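/- For a commutative nil-variety of semigroups V, the following conditions are equivalent: (a) V is an upper-modular element of the lattice Com; (b) V is a codistributive element of the lattice Com; (c) V is a costandard element of the lattice Com; (d) V satisfies the identities x²yz = 0 and x²y = xy². -/

import Mathlib

/-!
Formalization framework: semigroup varieties as Galois-closed equational theories
over the free semigroup on countably many letters.  A variety is represented by
its equational theory; the order `V ≤ W` ("V is a subvariety of W") is reverse
inclusion of theories.  `Com` is the lattice of commutative semigroup varieties,
realized as the subtype of varieties whose theory contains the commutative law.
-/

open FreeSemigroup

/-- Words: elements of the free semigroup over a countably infinite alphabet. -/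
abbrev Word : Type := FreeSemigroup ℕ

/-- A semigroup identity `u = v`. -/
abbrev SgId : Type := Word × Word

/-- `spow a n = a ^ (n + 1)` in any (multiplicative) semigroup. -/
def spow {M : Type*} [Mul M] (a : M) : ℕ → M
  | 0 => a
  | n + 1 => a * spow a n

/-- A semigroup `S` satisfies the identity `e.1 = e.2`. -/
def SatS (S : Type) [Semigroup S] (e : SgId) : Prop :=
  ∀ σ : ℕ → S, FreeSemigroup.lift σ e.1 = FreeSemigroup.lift σ e.2

/-- `S` is a model of the set of identities `E`. -/
def Models (S : Type) [Semigroup S] (E : Set SgId) : Prop :=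
  ∀ e ∈ E, SatS S e

/-- The equational theory generated by `E`: all identities holding in every
model of `E` (by Birkhoff's theorem this is exactly deductive closure). -/
def eqTh (E : Set SgId) : Set SgId :=
  { e | ∀ (S : Type) [Semigroup S], Models S E → SatS S e }

theorem subset_eqTh (E : Set SgId) : E ⊆ eqTh E := by
  intro e he S _ hS
  exact hS e he

theorem eqTh_mono {E F : Set SgId} (h : E ⊆ F) : eqTh E ⊆ eqTh F := by
  intro e he S _ hS
  exact he S fun e' he' => hS e' (h he')

theorem eqTh_idem (E : Set SgId) : eqTh (eqTh E) = eqTh E := by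
  refine Set.Subset.antisymm ?_ (subset_eqTh _)
  intro e he S _ hS
  exact he S fun e' he' => he' S hS

/-- A semigroup variety, given by its (Galois-closed) equational theory. -/
structure SgVariety where
  th : Set SgId
  closed : eqTh th = th

theorem SgVariety.ext' {V W : SgVariety} (h : V.th = W.th) : V = W := by
  cases V; cases W; cases h; rfl

/-- The variety defined by a set of identities. -/
def varOf (E : Set SgId) : SgVariety :=
  ⟨eqTh E, eqTh_idem E⟩

/-- `V ≤ W` iff `V` is a subvariety of `W`, i.e. the theory of `W` is contained
in the theory of `V`. -/
instance : PartialOrder SgVariety where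
  le V W := W.th ⊆ V.th
  le_refl V := Set.Subset.refl _
  le_trans a b c h1 h2 := Set.Subset.trans h2 h1
  le_antisymm a b h1 h2 := SgVariety.ext' (Set.Subset.antisymm h2 h1)

/-- The lattice **SEM** of all semigroup varieties: join is intersection of
theories; meet is the variety defined by the union of the theories. -/
instance : Lattice SgVariety :=
  { (inferInstance : PartialOrder SgVariety) with
    sup := fun V W =>
      ⟨V.th ∩ W.th, by
        refine Set.Subset.antisymm (Set.subset_inter ?_ ?_) (subset_eqTh _)
        · exact (eqTh_mono Set.inter_subset_left).trans (le_of_eq V.closed)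
        · exact (eqTh_mono Set.inter_subset_right).trans (le_of_eq W.closed)⟩
    le_sup_left := fun V W => Set.inter_subset_left
    le_sup_right := fun V W => Set.inter_subset_right
    sup_le := fun V W U h1 h2 => Set.subset_inter h1 h2
    inf := fun V W => varOf (V.th ∪ W.th)
    inf_le_left := fun V W => Set.subset_union_left.trans (subset_eqTh _)
    inf_le_right := fun V W => Set.subset_union_right.trans (subset_eqTh _)
    le_inf := fun U V W h1 h2 =>
      (eqTh_mono (Set.union_subset h1 h2)).trans (le_of_eq U.closed) }

/-- The letters `x`, `y`, `z`. -/
def xw : Word := FreeSemigroup.of 0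
def yw : Word := FreeSemigroup.of 1
def zw : Word := FreeSemigroup.of 2

/-- The commutative law `xy = yx`. -/
def commId : SgId := (xw * yw, yw * xw)

/-- The lattice **Com**: commutative semigroup varieties. -/
abbrev ComVariety : Type := { V : SgVariety // commId ∈ V.th }

instance : Lattice ComVariety :=
  { (inferInstance : PartialOrder ComVariety) with
    sup := fun V W => ⟨V.1 ⊔ W.1, ⟨V.2, W.2⟩⟩
    le_sup_left := fun V W => @le_sup_left SgVariety _ V.1 W.1
    le_sup_right := fun V W => @le_sup_right SgVariety _ V.1 W.1
    sup_le := fun V W U h1 h2 => @sup_le SgVariety _ V.1 W.1 U.1 h1 h2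
    inf := fun V W => ⟨V.1 ⊓ W.1, subset_eqTh _ (Set.mem_union_left _ V.2)⟩
    inf_le_left := fun V W => @inf_le_left SgVariety _ V.1 W.1
    inf_le_right := fun V W => @inf_le_right SgVariety _ V.1 W.1
    le_inf := fun U V W h1 h2 => @le_inf SgVariety _ U.1 V.1 W.1 h1 h2 }

/-- The trivial variety `T`. -/
def trivialVar : SgVariety := varOf Set.univ

/-- The variety `COM` of all commutative semigroups. -/
def COMvar : SgVariety := varOf {commId}

/-- The variety `SL` of semilattices. -/
def SLvar : SgVariety := varOf {commId, (xw * xw, xw)}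

/-- `C_m = var{xᵐ = xᵐ⁺¹, xy = yx}` for `m ≥ 1`, and `C_0 = T`. -/
def Cvar : ℕ → SgVariety
  | 0 => trivialVar
  | m + 1 => varOf {commId, (spow xw m, spow xw (m + 1))}

def Tcom : ComVariety := ⟨trivialVar, subset_eqTh _ (Set.mem_univ _)⟩
def COMcom : ComVariety := ⟨COMvar, subset_eqTh _ rfl⟩
def SLcom : ComVariety := ⟨SLvar, subset_eqTh _ (Set.mem_insert _ _)⟩
def Ccom (m : ℕ) : ComVariety :=
  ⟨Cvar m, by
    cases m with
    | zero => exact subset_eqTh _ (Set.mem_univ _)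
    | succ m => exact subset_eqTh _ (Set.mem_insert _ _)⟩

/-- A semigroup (nonempty, with the given multiplication) is a group. -/
def IsGroupS (S : Type) [Semigroup S] : Prop :=
  ∃ e : S, (∀ a : S, e * a = a ∧ a * e = a) ∧ ∀ a : S, ∃ b : S, a * b = e ∧ b * a = e

/-- A nilsemigroup: there is a zero element and some power of every element is zero. -/
def IsNilS (S : Type) [Semigroup S] : Prop :=
  ∃ z : S, (∀ a : S, z * a = z ∧ a * z = z) ∧ ∀ a : S, ∃ n : ℕ, spow a n = z

/-- A group variety: all its (nonempty) members are groups. -/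
def IsGroupVariety (V : SgVariety) : Prop :=
  ∀ (S : Type) [Semigroup S], Nonempty S → Models S V.th → IsGroupS S

/-- A nil-variety: all its (nonempty) members are nilsemigroups. -/
def IsNilVariety (V : SgVariety) : Prop :=
  ∀ (S : Type) [Semigroup S], Nonempty S → Models S V.th → IsNilS S

/-- A combinatorial variety: all groups in it are singletons. -/
def IsCombinatorial (V : SgVariety) : Prop :=
  ∀ (S : Type) [Semigroup S], Models S V.th → IsGroupS S → Subsingleton S

/-- A periodic variety: satisfies `xⁿ = xⁿ⁺ᵏ` for some `n, k ≥ 1`. -/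
def IsPeriodic (V : SgVariety) : Prop :=
  ∃ n k : ℕ, (spow xw n, spow xw (n + k + 1)) ∈ V.th

/-- The letter `k` occurs in the word `w`. -/
def occursIn (k : ℕ) (w : Word) : Prop := k = w.head ∨ k ∈ w.tail

/-- `S` satisfies the identity `w = 0` (i.e. the system `wx = xw = w`, `x` fresh):
every value of `w` in `S` is a (two-sided) zero element. -/
def SatZeroS (S : Type) [Semigroup S] (w : Word) : Prop :=
  ∀ (σ : ℕ → S) (a : S),
    FreeSemigroup.lift σ w * a = FreeSemigroup.lift σ w ∧
      a * FreeSemigroup.lift σ w = FreeSemigroup.lift σ w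

/-- The variety `V` satisfies the identity `w = 0`. -/
def VSatZero (V : SgVariety) (w : Word) : Prop :=
  ∀ (S : Type) [Semigroup S], Models S V.th → SatZeroS S w

/-- The words `x²`, `x³`, `x²y`, `xy²`, `x²yz`. -/
def w_xx : Word := xw * xw
def w_xxx : Word := xw * xw * xw
def w_xxy : Word := xw * xw * yw
def w_xyy : Word := xw * yw * yw
def w_xxyz : Word := xw * xw * yw * zw

/-- The identity `x²y = xy²`. -/
def idQ : SgId := (w_xxy, w_xyy)

/-- The pair of identities expressing `w = 0`, with `k` a fresh letter. -/
def zeroPair (w : Word) (k : ℕ) : Set SgId :=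
  {(w * FreeSemigroup.of k, w), (FreeSemigroup.of k * w, w)}

/-- `xprodTo n = x₁x₂⋯xₙ` (for `n ≥ 1`), on the letters `0, …, n-1`. -/
def xprodTo : ℕ → Word
  | 0 => FreeSemigroup.of 0
  | 1 => FreeSemigroup.of 0
  | n + 2 => xprodTo (n + 1) * FreeSemigroup.of (n + 1)

/-- `I = var{x²y = xy², x²yz = 0, xy = yx}`. -/
def Ivar : SgVariety := varOf ({commId, idQ} ∪ zeroPair w_xxyz 3)

/-- `K = var{x²y = 0, xy = yx}`. -/
def Kvar : SgVariety := varOf ({commId} ∪ zeroPair w_xxy 2)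

/-- `L = var{x² = 0, xy = yx}`. -/
def Lvar : SgVariety := varOf ({commId} ∪ zeroPair w_xx 1)

/-- `I_n = var{x²yz = x₁⋯xₙ = 0, x²y = xy², xy = yx}`. -/
def Ivarn (n : ℕ) : SgVariety :=
  varOf ({commId, idQ} ∪ zeroPair w_xxyz 3 ∪ zeroPair (xprodTo n) n)

/-- `J = var{x²yz = x³ = 0, x²y = xy², xy = yx}`. -/
def Jvar : SgVariety := varOf ({commId, idQ} ∪ zeroPair w_xxyz 3 ∪ zeroPair w_xxx 1)

/-- `J_n = var{x²yz = x³ = x₁⋯xₙ = 0, x²y = xy², xy = yx}`. -/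
def Jvarn (n : ℕ) : SgVariety :=
  varOf ({commId, idQ} ∪ zeroPair w_xxyz 3 ∪ zeroPair w_xxx 1 ∪ zeroPair (xprodTo n) n)

/-- `K_n = var{x²y = x₁⋯xₙ = 0, xy = yx}`. -/
def Kvarn (n : ℕ) : SgVariety :=
  varOf ({commId} ∪ zeroPair w_xxy 2 ∪ zeroPair (xprodTo n) n)

/-- `L_n = var{x² = x₁⋯xₙ = 0, xy = yx}`. -/
def Lvarn (n : ℕ) : SgVariety :=
  varOf ({commId} ∪ zeroPair w_xx 1 ∪ zeroPair (xprodTo n) n)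

/-- Generators of `ZR(U)`: the commutative law together with all 0-reduced
identities (in the form of the corresponding identity pairs) holding in `U`. -/
def ZRgen (U : SgVariety) : Set SgId :=
  {commId} ∪ { e : SgId | ∃ (w : Word) (k : ℕ), ¬ occursIn k w ∧ VSatZero U w ∧
      (e = (w * FreeSemigroup.of k, w) ∨ e = (FreeSemigroup.of k * w, w)) }

/-- `ZR(U)`: the variety given by the commutative law and all 0-reduced
identities holding in `U`. -/
def ZRvar (U : SgVariety) : SgVariety := varOf (ZRgen U)

def Icom : ComVariety := ⟨Ivar, subset_eqTh _ (Set.mem_union_left _ (Set.mem_insert _ _))⟩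

def ZRcom (U : SgVariety) : ComVariety :=
  ⟨ZRvar U, subset_eqTh _ (Set.mem_union_left _ rfl)⟩

/-- All nilsemigroups in `V` are nilpotent of degree ≤ n, i.e. satisfy `x₁⋯xₙ = 0`. -/
def HasDegLe (V : SgVariety) (n : ℕ) : Prop :=
  ∀ (S : Type) [Semigroup S], Nonempty S → Models S V.th → IsNilS S → SatZeroS S (xprodTo n)

/-- `deg V = d` (with `d = ⊤` meaning infinite degree). -/
def DegIs (V : SgVariety) (d : ℕ∞) : Prop :=
  (∃ n : ℕ, 0 < n ∧ d = (n : ℕ∞) ∧ IsLeast {m : ℕ | 0 < m ∧ HasDegLe V m} n) ∨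
    (d = ⊤ ∧ ∀ n : ℕ, 0 < n → ¬ HasDegLe V n)

/-- Upper-modular element of a lattice. -/
def IsUpperModular {L : Type*} [Lattice L] (a : L) : Prop :=
  ∀ b c : L, b ≤ a → a ⊓ (b ⊔ c) = b ⊔ (a ⊓ c)

/-- Codistributive element of a lattice. -/
def IsCodistributive {L : Type*} [Lattice L] (a : L) : Prop :=
  ∀ b c : L, a ⊓ (b ⊔ c) = (a ⊓ b) ⊔ (a ⊓ c)

/-- Costandard element of a lattice. -/
def IsCostandard {L : Type*} [Lattice L] (a : L) : Prop :=
  ∀ b c : L, (a ⊓ b) ⊔ c = (a ⊔ c) ⊓ (b ⊔ c)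

/-- Modular element of a lattice. -/
def IsModularElt {L : Type*} [Lattice L] (a : L) : Prop :=
  ∀ b c : L, b ≤ c → (a ⊔ b) ⊓ c = (a ⊓ c) ⊔ b

/-- Neutral element of a lattice, via the median characterization
(equivalent to: every triple containing `a` generates a distributive
sublattice; Grätzer, "Lattice Theory: Foundation", Theorem 254). -/
def IsNeutralElt {L : Type*} [Lattice L] (a : L) : Prop :=
  ∀ b c : L, (a ⊓ b) ⊔ (b ⊓ c) ⊔ (c ⊓ a) = (a ⊔ b) ⊓ (b ⊔ c) ⊓ (c ⊔ a)

/-! ### Fully invariant congruences on commutative words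

A commutative word is a nonempty multiset of letters, and substitution is `Multiset.bind`. -/

/-- A fully invariant congruence on commutative words, extended to the empty multiset,
which forms a class of its own. -/
structure FullyInvariant (R : Multiset ℕ → Multiset ℕ → Prop) : Prop where
  refl : ∀ s, R s s
  symm : ∀ {s t}, R s t → R t s
  trans : ∀ {s t r}, R s t → R t r → R s r
  add : ∀ {s t} (r), R s t → R (s + r) (t + r)
  subst : ∀ {s t} (φ : ℕ → Multiset ℕ), (∀ i, φ i ≠ 0) → R s t → R (s.bind φ) (t.bind φ)
  zero : ∀ {t}, R 0 t → t = 0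

/-- The commutative words `a²b` and `ab²` for distinct letters `a`, `b`. -/
def Swapped (s t : Multiset ℕ) : Prop :=
  ∃ a b : ℕ, a ≠ b ∧ s = {a, a, b} ∧ t = {a, b, b}

theorem Swapped.symm {s t : Multiset ℕ} (h : Swapped s t) : Swapped t s := by
  obtain ⟨a, b, hab, rfl, rfl⟩ := h
  refine ⟨b, a, hab.symm, ?_, ?_⟩ <;> ext c <;>
    simp [Multiset.count_cons, Multiset.count_singleton] <;> omega

theorem Swapped.right_unique {s t r : Multiset ℕ} (h : Swapped s t) (h' : Swapped s r) :
    t = r := by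
  obtain ⟨a, b, hab, rfl, rfl⟩ := h
  obtain ⟨c, d, hcd, h, rfl⟩ := h'
  have h1 := congrArg (Multiset.count a) h
  have h2 := congrArg (Multiset.count b) h
  simp only [Multiset.insert_eq_cons, Multiset.count_cons, Multiset.count_singleton] at h1 h2
  have hac : a = c := by
    by_contra hne
    grind
  have hbd : b = d := by
    by_contra hne
    grind
  rw [hac, hbd]

theorem Swapped.map_swap {s t : Multiset ℕ} (h : Swapped s t) :
    ∃ e : Equiv.Perm ℕ, s.map e = t ∧ t.map e = s := by
  obtain ⟨a, b, hab, rfl, rfl⟩ := h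
  refine ⟨Equiv.swap a b, ?_, ?_⟩ <;> ext c <;>
    simp [Multiset.count_cons, Multiset.count_singleton] <;> omega

namespace FullyInvariant

variable {R : Multiset ℕ → Multiset ℕ → Prop}

theorem map (hR : FullyInvariant R) {s t : Multiset ℕ} (f : ℕ → ℕ) (h : R s t) :
    R (s.map f) (t.map f) := by
  simpa only [Multiset.bind_singleton] using
    hR.subst (fun i => {f i}) (fun i => Multiset.singleton_ne_zero _) h

theorem ne_zero (hR : FullyInvariant R) {s t : Multiset ℕ} (h : R s t) (hs : s ≠ 0) : t ≠ 0 := by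
  rintro rfl
  exact hs (hR.zero (hR.symm h))

theorem add_both (hR : FullyInvariant R) {s P Q : Multiset ℕ} (h : R s (s + P))
    (h' : R s (s + Q)) : R s (s + (P + Q)) := by
  have := hR.add Q h
  rw [add_assoc] at this
  exact hR.trans h' this

theorem nsmul (hR : FullyInvariant R) {s P : Multiset ℕ} (h : R s (s + P)) (n : ℕ) :
    R s (s + n • P) := by
  induction n with
  | zero => simpa using hR.refl s
  | succ n ih =>
    rw [succ_nsmul]
    exact hR.add_both ih h

theorem sum (hR : FullyInvariant R) {ι : Type*} {s : Multiset ℕ} (F : Finset ι)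
    (P : ι → Multiset ℕ) (h : ∀ i ∈ F, R s (s + P i)) : R s (s + ∑ i ∈ F, P i) := by
  classical
  induction F using Finset.induction_on with
  | empty => simpa using hR.refl s
  | insert i F hi ih =>
    rw [Finset.sum_insert hi]
    exact hR.add_both (h i (Finset.mem_insert_self _ _))
      (ih fun j hj => h j (Finset.mem_insert_of_mem hj))

/-- Averaging over all permutations of the letters of a linear word. -/
theorem linear_symmetrize (hR : FullyInvariant R) {u P : Multiset ℕ} (hu : u.Nodup)
    (hP : P ≠ 0) (hPu : P ⊆ u) (h : R u (u + P)) : ∃ p, 0 < p ∧ R u (u + p • u) := by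
  classical
  let E : Equiv.Perm {x // x ∈ u} →* Equiv.Perm ℕ := Equiv.Perm.ofSubtype
  have hE : ∀ σ, u.map (E σ) = u := by
    intro σ
    have hsub : u.map (E σ) ⊆ u := by
      intro x hx
      obtain ⟨y, hy, rfl⟩ := Multiset.mem_map.1 hx
      have := Equiv.Perm.ofSubtype_apply_of_mem (p := (· ∈ u)) σ hy
      simp only [E, this]
      exact (σ ⟨y, hy⟩).2
    exact Multiset.eq_of_le_of_card_le
      ((Multiset.le_iff_subset (hu.map (E σ).injective)).2 hsub) (by simp)
  have : Finite {x // x ∈ u} :=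
    Finite.of_injective (fun x : {x // x ∈ u} => (⟨x.1, by simp [x.2]⟩ : {x // x ∈ u.toFinset}))
      fun x y hxy => Subtype.ext (congrArg (fun z => z.1) hxy)
  have := Fintype.ofFinite {x // x ∈ u}
  let Q : Multiset ℕ := ∑ σ : Equiv.Perm {x // x ∈ u}, P.map (E σ)
  have hQ : R u (u + Q) := by
    refine hR.sum _ _ fun σ _ => ?_
    have := hR.map (E σ) h
    rwa [Multiset.map_add, hE] at this
  have hQu : Q ⊆ u := by
    intro x hx
    obtain ⟨σ, -, hx⟩ := Multiset.mem_sum.1 hx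
    obtain ⟨y, hy, rfl⟩ := Multiset.mem_map.1 hx
    have := Multiset.mem_map_of_mem (E σ) (hPu hy)
    rwa [hE] at this
  have hQinv : ∀ τ, Q.map (E τ) = Q := by
    intro τ
    change Multiset.mapAddMonoidHom (E τ) Q = Q
    simp only [Q, map_sum]
    refine Fintype.sum_equiv (Equiv.mulLeft τ) _ _ fun σ => ?_
    simp [Multiset.map_map, Function.comp_def]
  have hcount : ∀ x ∈ u, ∀ y ∈ u, Q.count x = Q.count y := by
    intro x hx y hy
    have h1 := Multiset.count_map_eq_count' _ Q (E (Equiv.swap ⟨x, hx⟩ ⟨y, hy⟩)).injective x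
    rw [hQinv] at h1
    simpa [E, Equiv.Perm.ofSubtype_swap_eq] using h1.symm
  obtain ⟨a, ha⟩ := Multiset.exists_mem_of_ne_zero hP
  have haQ : a ∈ Q := Multiset.mem_sum.2 ⟨1, Finset.mem_univ _, by simpa using ha⟩
  refine ⟨Q.count a, Multiset.count_pos.2 haQ, ?_⟩
  have hQeq : Q = Q.count a • u := by
    ext x
    rw [Multiset.count_nsmul]
    by_cases hx : x ∈ u
    · rw [Multiset.count_eq_one_of_mem hu hx, mul_one]
      exact hcount x hx a (hPu ha)
    · rw [Multiset.count_eq_zero_of_notMem hx, mul_zero,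
        Multiset.count_eq_zero_of_notMem fun h => hx (hQu h)]
  rwa [← hQeq]

theorem linear_period (hR : FullyInvariant R) {u w : Multiset ℕ} (hu : u.Nodup) (hu0 : u ≠ 0)
    (h : R u w) (hw : w ≠ u) : ∃ p, 0 < p ∧ R u (u + p • u) := by
  classical
  by_cases huw : u ⊆ w
  · obtain ⟨P, rfl⟩ := Multiset.le_iff_exists_add.1 ((Multiset.le_iff_subset hu).2 huw)
    obtain ⟨a, ha⟩ := Multiset.exists_mem_of_ne_zero hu0
    let f : ℕ → ℕ := fun i => if i ∈ u then i else a
    have hfu : u.map f = u := by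
      conv_rhs => rw [← Multiset.map_id u]
      exact Multiset.map_congr rfl fun x hx => by simp [f, hx]
    have h1 := hR.map f h
    rw [Multiset.map_add, hfu] at h1
    refine hR.linear_symmetrize hu (P := P.map f) ?_ ?_ h1
    · rw [Ne, Multiset.map_eq_zero]
      rintro rfl
      exact hw (add_zero u)
    · intro x hx
      obtain ⟨y, -, rfl⟩ := Multiset.mem_map.1 hx
      by_cases hy : y ∈ u <;> simp [f, hy, ha]
  · obtain ⟨t, htu, htw⟩ := by simpa [Multiset.subset_iff] using huw
    obtain ⟨v, rfl⟩ := Multiset.exists_cons_of_mem htu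
    have htv := (Multiset.nodup_cons.1 hu).1
    let φ : ℕ → Multiset ℕ := fun i => if i = t then {t, t} else {i}
    have hφ : ∀ s : Multiset ℕ, t ∉ s → s.bind φ = s := by
      intro s hs
      conv_rhs => rw [← Multiset.map_id s, ← Multiset.bind_singleton]
      refine Multiset.bind_congr fun x hx => ?_
      have : x ≠ t := fun h => hs (h ▸ hx)
      simp [φ, this]
    have h1 := hR.subst φ (fun i => by by_cases hi : i = t <;> simp [φ, hi]) h
    rw [hφ w htw, Multiset.cons_bind, hφ v htv] at h1
    refine hR.linear_symmetrize hu (P := {t}) (Multiset.singleton_ne_zero _)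
      (by simp) (hR.trans h (hR.symm ?_))
    convert h1 using 1
    ext c
    simp only [φ, if_true, Multiset.count_add, Multiset.insert_eq_cons, Multiset.count_cons,
      Multiset.count_singleton]
    omega

theorem power_period (hR : FullyInvariant R) {k x : ℕ} {w : Multiset ℕ} (hk : 0 < k)
    (h : R (Multiset.replicate k x) w) (hw : w ≠ Multiset.replicate k x) :
    ∃ p, 0 < p ∧ R (Multiset.replicate k x) (Multiset.replicate k x + p • {x}) := by
  have key : ∀ j, 0 < j → j ≠ k → R (Multiset.replicate k x) (Multiset.replicate j x) →
      ∃ p, 0 < p ∧ R (Multiset.replicate k x) (Multiset.replicate k x + p • {x}) := by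
    intro j hj hjk hR'
    rcases lt_or_gt_of_ne hjk with hlt | hlt
    · refine ⟨k - j, by omega, ?_⟩
      have h1 := hR.add (Multiset.replicate (k - j) x) hR'
      rw [← Multiset.replicate_add, ← Multiset.replicate_add] at h1
      rw [Multiset.nsmul_singleton, ← Multiset.replicate_add]
      have hjk' : j + (k - j) = k := by omega
      rw [hjk'] at h1
      exact hR.symm h1
    · refine ⟨j - k, by omega, ?_⟩
      rw [Multiset.nsmul_singleton, ← Multiset.replicate_add]
      have hjk' : k + (j - k) = j := by omega
      rwa [hjk']
  by_cases hx : ∀ t ∈ w, t = x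
  · rw [Multiset.eq_replicate_card.2 hx] at h hw
    refine key _ ?_ ?_ h
    · rw [Multiset.card_pos]
      rintro rfl
      exact hR.ne_zero h (by simpa [Multiset.card_eq_zero, ← Multiset.card_pos] using hk) rfl
    · rintro rfl
      exact hw rfl
  · push Not at hx
    obtain ⟨t, htw, htx⟩ := hx
    obtain ⟨v, rfl⟩ := Multiset.exists_cons_of_mem htw
    let φ : ℕ → Multiset ℕ := fun i => if i = x then {x} else Multiset.replicate (k + 1) x
    have h1 := hR.subst φ (fun i => by by_cases hi : i = x <;> simp [φ, hi]) h
    have h2 : (Multiset.replicate k x).bind φ = Multiset.replicate k x := by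
      conv_rhs => rw [← Multiset.map_id (Multiset.replicate k x), ← Multiset.bind_singleton]
      refine Multiset.bind_congr fun y hy => ?_
      simp [φ, Multiset.eq_of_mem_replicate hy]
    have h3 : ∀ y ∈ (t ::ₘ v).bind φ, y = x := by
      intro y hy
      obtain ⟨i, -, hi⟩ := Multiset.mem_bind.1 hy
      by_cases hix : i = x
      · simpa [φ, hix] using hi
      · simp only [φ, hix, if_false] at hi
        exact Multiset.eq_of_mem_replicate hi
    have h4 : k + 1 ≤ ((t ::ₘ v).bind φ).card := by simp [φ, htx]
    rw [h2, Multiset.eq_replicate_card.2 h3] at h1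
    exact key _ (by omega) (by omega) h1

end FullyInvariant

/-- The commutative word `xⁱyʲ`. -/
def biWord (x y i j : ℕ) : Multiset ℕ := Multiset.replicate i x + Multiset.replicate j y

theorem biWord_add (x y i j k l : ℕ) :
    biWord x y i j + biWord x y k l = biWord x y (i + k) (j + l) := by
  simp only [biWord, Multiset.replicate_add]
  abel

theorem biWord_bind {x y : ℕ} (φ : ℕ → Multiset ℕ) {a b c d : ℕ} (hx : φ x = biWord x y a b)
    (hy : φ y = biWord x y c d) (i j : ℕ) :
    (biWord x y i j).bind φ = biWord x y (i * a + j * c) (i * b + j * d) := by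
  have hrep : ∀ n z, (Multiset.replicate n z).bind φ = n • φ z := by
    intro n z
    rw [Multiset.bind, Multiset.map_replicate, Multiset.join, Multiset.sum_replicate]
  rw [biWord, Multiset.add_bind, hrep, hrep, hx, hy]
  simp only [biWord, nsmul_add, Multiset.nsmul_replicate, Multiset.replicate_add]
  abel

namespace FullyInvariant

variable {R : Multiset ℕ → Multiset ℕ → Prop}

section TwoLetters

variable {x y : ℕ}

theorem biWord_shift (hR : FullyInvariant R) {i j k l : ℕ} (m n : ℕ)
    (h : R (biWord x y i j) (biWord x y k l)) :
    R (biWord x y (i + m) (j + n)) (biWord x y (k + m) (l + n)) := by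
  simpa only [biWord_add] using hR.add (biWord x y m n) h

theorem biWord_iterate (hR : FullyInvariant R) {i j c d : ℕ}
    (h : R (biWord x y i j) (biWord x y (i + c) (j + d))) (n : ℕ) :
    R (biWord x y i j) (biWord x y (i + n * c) (j + n * d)) := by
  rw [← biWord_add] at h
  have h1 := hR.nsmul h n
  simpa only [biWord, nsmul_add, Multiset.nsmul_replicate, add_assoc, Multiset.replicate_add,
    add_left_comm] using h1

theorem biWord_subst (hR : FullyInvariant R) (hxy : x ≠ y) {i j k l : ℕ} (a b c d : ℕ)
    (hab : 0 < a + b) (hcd : 0 < c + d) (h : R (biWord x y i j) (biWord x y k l)) :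
    R (biWord x y (i * a + j * c) (i * b + j * d))
      (biWord x y (k * a + l * c) (k * b + l * d)) := by
  let φ : ℕ → Multiset ℕ := fun n =>
    if n = x then biWord x y a b else if n = y then biWord x y c d else {n}
  have hx : φ x = biWord x y a b := by simp [φ]
  have hy : φ y = biWord x y c d := by simp [φ, hxy.symm]
  have hφ : ∀ n, φ n ≠ 0 := by
    intro n
    rw [← Multiset.card_pos]
    by_cases h1 : n = x
    · simp only [φ, h1, if_true, biWord, Multiset.card_add, Multiset.card_replicate]
      omega
    by_cases h2 : n = y
    · simp only [φ, h2, hxy.symm, if_true, if_false, biWord, Multiset.card_add,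
        Multiset.card_replicate]
      omega
    · simp [φ, h1, h2]
  have h1 := hR.subst φ hφ h
  rwa [biWord_bind φ hx hy, biWord_bind φ hx hy] at h1

/-- `x²y = x^(2+c) y^(1+d)` with `c, d > 0` yields `x²y = x^(2+p) y`. -/
theorem period_of_pos_of_pos (hR : FullyInvariant R) (hxy : x ≠ y) {c d : ℕ} (hc : 0 < c)
    (h : R (biWord x y 2 1) (biWord x y (2 + c) (1 + d))) :
    ∃ p, 0 < p ∧ R (biWord x y 2 1) (biWord x y (2 + p) 1) := by
  obtain ⟨p, hp⟩ : ∃ p, p = c + d := ⟨_, rfl⟩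
  refine ⟨p, by omega, ?_⟩
  have h1 := hR.biWord_iterate h (3 * p)
  have h2 : R (biWord x y (2 + p) 1) (biWord x y (2 + p + (c + p * d)) (1 + d)) := by
    convert hR.biWord_subst hxy 1 0 p 1 (by omega) (by omega) h using 2 <;> ring
  have h3 := hR.biWord_iterate h2 (3 * p)
  have h4 : R (biWord x y 3 0) (biWord x y (3 + p) (0 + 0)) := by
    convert hR.biWord_subst hxy 1 0 1 0 (by omega) (by omega) h using 2 <;> omega
  have h5 := hR.biWord_iterate h4 (1 + 3 * p * d)
  have hpc : 0 < p * c := Nat.mul_pos (by omega) hc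
  have h6 := hR.biWord_shift (3 * p * c - 1) (1 + 3 * p * d) h5
  refine hR.trans h1 (hR.trans ?_ (hR.symm h3))
  convert h6 using 2
  · have : 3 * p * c = 3 * (p * c) := by ring
    omega
  · ring
  · have h7 : 3 * p * (c + p * d) = 3 * p * c + 3 * p * p * d := by ring
    have h8 : (1 + 3 * p * d) * p = p + 3 * p * p * d := by ring
    have : 3 * p * c = 3 * (p * c) := by ring
    omega
  · ring

/-- A nontrivial consequence `x²y = x^(2+c) y^(1+d)` yields `x²y = x^(2+p) y`. -/
theorem period_of_extension (hR : FullyInvariant R) (hxy : x ≠ y) {c d : ℕ} (hcd : 0 < c + d)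
    (h : R (biWord x y 2 1) (biWord x y (2 + c) (1 + d))) :
    ∃ p, 0 < p ∧ R (biWord x y 2 1) (biWord x y (2 + p) 1) := by
  rcases Nat.eq_zero_or_pos c with rfl | hc
  · obtain ⟨e, rfl⟩ : ∃ e, d = e + 1 := ⟨d - 1, by omega⟩
    have h1 := hR.biWord_iterate h 2
    have h2 := hR.biWord_subst hxy 0 1 2 (1 + 2 * e) (by omega) (by omega) h
    refine hR.period_of_pos_of_pos hxy (c := 2 * (e + 1))
      (d := 1 + (2 * e + 1) * (e + 2)) (by omega) (hR.trans h1 ?_)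
    convert h2 using 2 <;> ring
  · exact hR.period_of_pos_of_pos hxy hc h

theorem period_of_biWord (hR : FullyInvariant R) (hxy : x ≠ y) {i j : ℕ}
    (h : R (biWord x y 2 1) (biWord x y i j)) (h0 : 0 < i + j) (h21 : ¬ (i = 2 ∧ j = 1))
    (h12 : ¬ (i = 1 ∧ j = 2)) : ∃ p, 0 < p ∧ R (biWord x y 2 1) (biWord x y (2 + p) 1) := by
  by_cases hj : j = 0
  · subst hj
    have h1 := hR.biWord_subst hxy 1 0 1 1 (by omega) (by omega) h
    refine ⟨1, one_pos, hR.trans h (hR.symm ?_)⟩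
    simpa using h1
  by_cases hi : i = 0
  · subst hi
    have h1 := hR.biWord_subst hxy 2 0 0 1 (by omega) (by omega) h
    refine ⟨2, two_pos, hR.trans h (hR.symm ?_)⟩
    simpa using h1
  by_cases hi1 : i = 1
  · subst hi1
    by_cases hj1 : j = 1
    · subst hj1
      exact ⟨1, one_pos, hR.symm (hR.biWord_shift 1 0 h)⟩
    · obtain ⟨k, rfl⟩ : ∃ k, j = k + 3 := ⟨j - 3, by omega⟩
      have h1 := hR.biWord_subst hxy 0 1 1 0 (by omega) (by omega) h
      have h2 := hR.biWord_shift 0 (k + 1) h1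
      refine hR.period_of_extension hxy (c := k + 1) (d := k + 1) (by omega) (hR.trans h ?_)
      convert h2 using 2 <;> omega
  · obtain ⟨c, rfl⟩ : ∃ c, i = 2 + c := ⟨i - 2, by omega⟩
    obtain ⟨d, rfl⟩ : ∃ d, j = 1 + d := ⟨j - 1, by omega⟩
    exact hR.period_of_extension hxy (by omega) h

theorem eq_biWord {w : Multiset ℕ} (hxy : x ≠ y) (hw : ∀ t ∈ w, t = x ∨ t = y) :
    w = biWord x y (w.count x) (w.count y) := by
  ext t
  simp only [biWord, Multiset.count_add, Multiset.count_replicate]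
  by_cases htx : t = x
  · subst htx
    simp [hxy.symm]
  by_cases hty : t = y
  · subst hty
    simp [hxy]
  · rw [Multiset.count_eq_zero_of_notMem fun h => (hw t h).elim htx hty]
    simp [Ne.symm htx, Ne.symm hty]

theorem square_mul_period (hR : FullyInvariant R) (hxy : x ≠ y) {w : Multiset ℕ}
    (h : R {x, x, y} w) (hw : w ≠ {x, x, y}) (hw' : w ≠ {x, y, y}) :
    ∃ p, 0 < p ∧ R {x, x, y} ({x, x, y} + p • {x}) := by
  have hxxy : ({x, x, y} : Multiset ℕ) = biWord x y 2 1 := rfl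
  have hxyy : ({x, y, y} : Multiset ℕ) = biWord x y 1 2 := rfl
  have hgoal : ∀ p, ({x, x, y} + p • {x} : Multiset ℕ) = biWord x y (2 + p) 1 := by
    intro p
    rw [Multiset.nsmul_singleton, hxxy, ← add_zero 1, ← biWord_add]
    simp [biWord]
  simp only [hgoal]
  rw [hxxy] at h hw ⊢
  rw [hxyy] at hw'
  by_cases hl : ∀ t ∈ w, t = x ∨ t = y
  · rw [eq_biWord hxy hl] at h hw hw'
    refine hR.period_of_biWord hxy h ?_ ?_ ?_
    · by_contra h0
      refine hR.ne_zero h (by simp [biWord]) ?_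
      have h1 : w.count x = 0 := by omega
      have h2 : w.count y = 0 := by omega
      simp [biWord, h1, h2]
    · rintro ⟨h1, h2⟩
      rw [h1, h2] at hw
      exact hw rfl
    · rintro ⟨h1, h2⟩
      rw [h1, h2] at hw'
      exact hw' rfl
  · push Not at hl
    obtain ⟨t, htw, htx, hty⟩ := hl
    obtain ⟨v, rfl⟩ := Multiset.exists_cons_of_mem htw
    let φ : ℕ → Multiset ℕ := fun n => if n = x ∨ n = y then {n} else biWord x y 3 3
    have hφ : ∀ n, φ n ≠ 0 := by
      intro n
      by_cases hn : n = x ∨ n = y <;> simp [φ, hn, biWord]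
    have h1 := hR.subst φ hφ h
    have h2 := biWord_bind (x := x) (y := y) φ (a := 1) (b := 0) (c := 0) (d := 1)
      (by simp [φ, biWord]) (by simp [φ, biWord]) 2 1
    have h3 : ∀ z ∈ (t ::ₘ v).bind φ, z = x ∨ z = y := by
      intro z hz
      obtain ⟨n, -, hn⟩ := Multiset.mem_bind.1 hz
      by_cases hnn : n = x ∨ n = y
      · simp only [φ, hnn, if_true, Multiset.mem_singleton] at hn
        rwa [hn]
      · simp only [φ, hnn, if_false, biWord, Multiset.mem_add] at hn
        exact hn.imp Multiset.eq_of_mem_replicate Multiset.eq_of_mem_replicate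
    have h4 : ∀ z, z = x ∨ z = y → 3 ≤ ((t ::ₘ v).bind φ).count z := by
      rintro z (rfl | rfl) <;>
        simp only [Multiset.cons_bind, φ, htx, hty, or_self, if_false, biWord,
          Multiset.count_add, Multiset.count_replicate_self] <;> omega
    rw [h2, eq_biWord hxy h3] at h1
    have hx3 := h4 x (Or.inl rfl)
    have hy3 := h4 y (Or.inr rfl)
    exact hR.period_of_biWord hxy h1 (by omega) (by omega) (by omega)

end TwoLetters

/-- For a linear or short commutative word `s` there is a direction `P` in which every
nontrivial identity `s = w`, apart from `a²b = ab²`, makes `s` periodic. -/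
theorem exists_direction {s : Multiset ℕ} (hs0 : s ≠ 0) (hs : s.Nodup ∨ s.card ≤ 3) :
    ∃ P : Multiset ℕ, P ≠ 0 ∧ ∀ R, FullyInvariant R → ∀ w, R s w → w ≠ s → ¬ Swapped s w →
      ∃ p, 0 < p ∧ R s (s + p • P) := by
  by_cases hnd : s.Nodup
  · exact ⟨s, hs0, fun R hR w h hw _ => hR.linear_period hnd hs0 h hw⟩
  · have hcard := hs.resolve_left hnd
    rw [Multiset.nodup_iff_ne_cons_cons] at hnd
    push Not at hnd
    obtain ⟨a, t, rfl⟩ := hnd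
    refine ⟨{a}, Multiset.singleton_ne_zero a, fun R hR w h hw hsw => ?_⟩
    rw [Multiset.card_cons, Multiset.card_cons] at hcard
    obtain h0 | h1 : t.card = 0 ∨ t.card = 1 := by omega
    · rw [Multiset.card_eq_zero] at h0
      subst h0
      exact hR.power_period (k := 2) two_pos h hw
    · obtain ⟨b, rfl⟩ := Multiset.card_eq_one.1 h1
      by_cases hab : a = b
      · subst hab
        exact hR.power_period (k := 3) three_pos h hw
      · exact hR.square_mul_period hab h hw fun h' => hsw ⟨a, b, hab, rfl, h'⟩

end FullyInvariant

/-! ### Commutative varieties as fully invariant congruences -/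

/-- The commutative word underlying a word. -/
def content (w : Word) : Multiset ℕ := (w.head :: w.tail : List ℕ)

@[simp] theorem content_of (a : ℕ) : content (FreeSemigroup.of a) = {a} := rfl

@[simp] theorem content_mul (u v : Word) : content (u * v) = content u + content v := rfl

theorem content_ne_zero (w : Word) : content w ≠ 0 := by
  simp [content]

theorem exists_content_eq {s : Multiset ℕ} (hs : s ≠ 0) : ∃ w, content w = s := by
  induction s using Quotient.inductionOn with
  | h l =>
    cases l with
    | nil => exact absurd rfl hs
    | cons a l => exact ⟨⟨a, l⟩, rfl⟩

theorem content_lift (τ : ℕ → Word) (w : Word) :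
    content (FreeSemigroup.lift τ w) = (content w).bind fun i => content (τ i) := by
  induction w using FreeSemigroup.recOnMul with
  | ih1 a => simp
  | ih2 a w _ ih => simp [ih]

theorem lift_eq_prod {S : Type} [CommSemigroup S] (σ : ℕ → S) (w : Word) :
    (FreeSemigroup.lift σ w : WithOne S) = ((content w).map fun i => (σ i : WithOne S)).prod := by
  induction w using FreeSemigroup.recOnMul with
  | ih1 a => simp
  | ih2 a w _ ih => simp [ih]

theorem lift_eq_of_content_eq {S : Type} [Semigroup S] (hS : SatS S commId) (σ : ℕ → S)
    {u v : Word} (h : content u = content v) :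
    FreeSemigroup.lift σ u = FreeSemigroup.lift σ v := by
  let _ : CommSemigroup S :=
    { mul_comm := fun a b => by
        simpa [commId, xw, yw] using hS fun i => if i = 0 then a else b }
  apply WithOne.coe_injective
  rw [lift_eq_prod σ u, lift_eq_prod σ v, h]

theorem mem_th_of_content_eq (V : ComVariety) {u v : Word} (h : content u = content v) :
    (u, v) ∈ V.1.th := by
  rw [← V.1.closed]
  exact fun S _ hS σ => lift_eq_of_content_eq (hS _ V.2) σ h

/-- The fully invariant congruence on commutative words given by a commutative variety. -/
def rel (V : ComVariety) (s t : Multiset ℕ) : Prop :=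
  s = t ∨ ∃ u v, content u = s ∧ content v = t ∧ (u, v) ∈ V.1.th

theorem th_symm (V : ComVariety) {u v : Word} (h : (u, v) ∈ V.1.th) : (v, u) ∈ V.1.th := by
  rw [← V.1.closed]
  exact fun S _ hS σ => (hS _ h σ).symm

theorem th_trans (V : ComVariety) {u v w : Word} (h : (u, v) ∈ V.1.th) (h' : (v, w) ∈ V.1.th) :
    (u, w) ∈ V.1.th := by
  rw [← V.1.closed]
  exact fun S _ hS σ => (hS _ h σ).trans (hS _ h' σ)

theorem th_mul (V : ComVariety) {u v : Word} (w : Word) (h : (u, v) ∈ V.1.th) :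
    (u * w, v * w) ∈ V.1.th := by
  rw [← V.1.closed]
  intro S _ hS σ
  have : FreeSemigroup.lift σ u = FreeSemigroup.lift σ v := hS _ h σ
  simp only [map_mul, this]

theorem th_lift (V : ComVariety) {u v : Word} (τ : ℕ → Word) (h : (u, v) ∈ V.1.th) :
    (FreeSemigroup.lift τ u, FreeSemigroup.lift τ v) ∈ V.1.th := by
  rw [← V.1.closed]
  intro S _ hS σ
  have hcomp : (FreeSemigroup.lift σ).comp (FreeSemigroup.lift τ) =
      FreeSemigroup.lift (fun i => FreeSemigroup.lift σ (τ i)) := by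
    ext i
    simp
  have h1 := hS _ h fun i => FreeSemigroup.lift σ (τ i)
  rw [← hcomp] at h1
  exact h1

theorem mem_th_iff (V : ComVariety) (u v : Word) :
    (u, v) ∈ V.1.th ↔ rel V (content u) (content v) := by
  constructor
  · exact fun h => Or.inr ⟨u, v, rfl, rfl, h⟩
  · rintro (h | ⟨u', v', hu, hv, h⟩)
    · exact mem_th_of_content_eq V h
    · exact th_trans V (mem_th_of_content_eq V hu.symm)
        (th_trans V h (mem_th_of_content_eq V hv))

theorem fullyInvariant_rel (V : ComVariety) : FullyInvariant (rel V) where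
  refl s := Or.inl rfl
  symm := by
    rintro s t (rfl | ⟨u, v, rfl, rfl, h⟩)
    · exact Or.inl rfl
    · exact Or.inr ⟨v, u, rfl, rfl, th_symm V h⟩
  trans := by
    rintro s t r (rfl | ⟨u, v, rfl, rfl, h⟩) h'
    · exact h'
    · rcases h' with rfl | ⟨v', w, hv, rfl, h'⟩
      · exact Or.inr ⟨u, v, rfl, rfl, h⟩
      · exact Or.inr ⟨u, w, rfl, rfl,
          th_trans V h (th_trans V (mem_th_of_content_eq V hv.symm) h')⟩
  add := by
    rintro s t r (rfl | ⟨u, v, rfl, rfl, h⟩)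
    · exact Or.inl rfl
    · by_cases hr : r = 0
      · subst hr
        simpa using (mem_th_iff V u v).1 h
      · obtain ⟨w, rfl⟩ := exists_content_eq hr
        exact Or.inr ⟨u * w, v * w, rfl, rfl, th_mul V w h⟩
  subst := by
    rintro s t φ hφ (rfl | ⟨u, v, rfl, rfl, h⟩)
    · exact Or.inl rfl
    · choose τ hτ using fun i => exists_content_eq (hφ i)
      exact Or.inr ⟨_, _, by simp only [content_lift, hτ], by simp only [content_lift, hτ],
        th_lift V τ h⟩
  zero := by
    rintro t (rfl | ⟨u, v, hu, rfl, h⟩)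
    · rfl
    · exact absurd hu (content_ne_zero u)

namespace FullyInvariant

variable {R : Multiset ℕ → Multiset ℕ → Prop}

/-- The congruence on words induced by a fully invariant congruence on commutative words. -/
def wordCon (hR : FullyInvariant R) : Con Word where
  r u v := R (content u) (content v)
  iseqv := ⟨fun u => hR.refl _, fun h => hR.symm h, fun h h' => hR.trans h h'⟩
  mul' := by
    intro u v u' v' h h'
    have h1 := hR.add (content u') h
    have h2 := hR.add (content v) h'
    rw [add_comm, add_comm (content v')] at h2
    exact hR.trans h1 h2

theorem wordCon_eq (hR : FullyInvariant R) {u v : Word} :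
    (u : hR.wordCon.Quotient) = v ↔ R (content u) (content v) :=
  hR.wordCon.eq

/-- The identities that hold in the relatively free semigroup of `R`. -/
theorem satS_quotient_iff (hR : FullyInvariant R) (e : SgId) :
    SatS hR.wordCon.Quotient e ↔ R (content e.1) (content e.2) := by
  have hlift : ∀ (τ : ℕ → Word) (w : Word),
      FreeSemigroup.lift (fun i => (τ i : hR.wordCon.Quotient)) w =
        ((FreeSemigroup.lift τ w : Word) : hR.wordCon.Quotient) := by
    intro τ w
    induction w using FreeSemigroup.recOnMul with
    | ih1 a => simp
    | ih2 a w _ ih => simp [ih]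
  constructor
  · intro h
    have h1 := h fun i => ((FreeSemigroup.of i : Word) : hR.wordCon.Quotient)
    rw [hlift, hlift, hR.wordCon_eq, content_lift, content_lift] at h1
    have hid : ∀ s : Multiset ℕ, (s.bind fun i => {i}) = s := fun s =>
      (Multiset.bind_singleton s id).trans (Multiset.map_id s)
    simpa only [content_of, hid] using h1
  · intro h σ
    choose τ hτ using fun i => Quotient.exists_rep (σ i)
    obtain rfl : σ = fun i => (τ i : hR.wordCon.Quotient) := funext fun i => (hτ i).symm
    rw [hlift, hlift, hR.wordCon_eq, content_lift, content_lift]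
    exact hR.subst _ (fun i => content_ne_zero _) h

/-- The commutative variety given by a fully invariant congruence on commutative words. -/
def toVariety (hR : FullyInvariant R) : ComVariety :=
  ⟨⟨{e | R (content e.1) (content e.2)}, by
      refine Set.Subset.antisymm (fun e he => ?_) (subset_eqTh _)
      exact (hR.satS_quotient_iff e).1 (he _ fun e' he' => (hR.satS_quotient_iff e').2 he')⟩,
    by
      change R (content (xw * yw)) (content (yw * xw))
      rw [content_mul, content_mul, add_comm]
      exact hR.refl _⟩

theorem rel_toVariety (hR : FullyInvariant R) (s t : Multiset ℕ) :
    rel hR.toVariety s t ↔ R s t := by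
  constructor
  · rintro (rfl | ⟨u, v, rfl, rfl, h⟩)
    · exact hR.refl s
    · exact h
  · intro h
    by_cases hs : s = 0
    · subst hs
      exact Or.inl (hR.zero h).symm
    · obtain ⟨u, rfl⟩ := exists_content_eq hs
      obtain ⟨v, rfl⟩ := exists_content_eq (hR.ne_zero h hs)
      exact Or.inr ⟨u, v, rfl, rfl, h⟩

theorem models_quotient_rel (V : ComVariety) :
    Models (fullyInvariant_rel V).wordCon.Quotient V.1.th := fun e he =>
  ((fullyInvariant_rel V).satS_quotient_iff e).2 ((mem_th_iff V _ _).1 he)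

end FullyInvariant

theorem ComVariety.le_iff (V W : ComVariety) : V ≤ W ↔ ∀ s t, rel W s t → rel V s t := by
  constructor
  · rintro h s t (rfl | ⟨u, v, rfl, rfl, huv⟩)
    · exact Or.inl rfl
    · exact Or.inr ⟨u, v, rfl, rfl, h huv⟩
  · rintro h ⟨u, v⟩ huv
    exact (mem_th_iff V u v).2 (h _ _ ((mem_th_iff W u v).1 huv))

theorem rel_sup (V W : ComVariety) (s t : Multiset ℕ) :
    rel (V ⊔ W) s t ↔ rel V s t ∧ rel W s t := by
  constructor
  · exact fun h => ⟨(ComVariety.le_iff _ _).1 le_sup_left s t h,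
      (ComVariety.le_iff _ _).1 le_sup_right s t h⟩
  · rintro ⟨h, hW⟩
    by_cases hs : s = 0
    · subst hs
      exact Or.inl ((fullyInvariant_rel V).zero h).symm
    · obtain ⟨u, rfl⟩ := exists_content_eq hs
      obtain ⟨v, rfl⟩ := exists_content_eq ((fullyInvariant_rel V).ne_zero h hs)
      exact Or.inr ⟨u, v, rfl, rfl, (mem_th_iff V u v).2 h, (mem_th_iff W u v).2 hW⟩

/-- Words connected by a chain of steps from `A` and `B`. -/
def chain (A B : Multiset ℕ → Multiset ℕ → Prop) : Multiset ℕ → Multiset ℕ → Prop :=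
  Relation.ReflTransGen fun s t => A s t ∨ B s t

theorem fullyInvariant_chain {A B : Multiset ℕ → Multiset ℕ → Prop} (hA : FullyInvariant A)
    (hB : FullyInvariant B) : FullyInvariant (chain A B) where
  refl s := Relation.ReflTransGen.refl
  symm h := by
    induction h with
    | refl => exact Relation.ReflTransGen.refl
    | tail _ h ih => exact Relation.ReflTransGen.head (h.imp hA.symm hB.symm) ih
  trans := Relation.ReflTransGen.trans
  add r h := by
    induction h with
    | refl => exact Relation.ReflTransGen.refl
    | tail _ h ih => exact Relation.ReflTransGen.tail ih (h.imp (hA.add r) (hB.add r))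
  subst φ hφ h := by
    induction h with
    | refl => exact Relation.ReflTransGen.refl
    | tail _ h ih => exact Relation.ReflTransGen.tail ih (h.imp (hA.subst φ hφ) (hB.subst φ hφ))
  zero h := by
    induction h with
    | refl => rfl
    | tail _ h ih =>
      subst ih
      exact h.elim hA.zero hB.zero

theorem rel_inf (V W : ComVariety) (s t : Multiset ℕ) :
    rel (V ⊓ W) s t ↔ chain (rel V) (rel W) s t := by
  have hC := fullyInvariant_chain (fullyInvariant_rel V) (fullyInvariant_rel W)
  constructor
  · intro h
    rw [← hC.rel_toVariety]
    refine (ComVariety.le_iff _ _).1 (le_inf ?_ ?_) s t h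
    · exact (ComVariety.le_iff _ _).2 fun s t h =>
        (hC.rel_toVariety s t).2 (Relation.ReflTransGen.single (Or.inl h))
    · exact (ComVariety.le_iff _ _).2 fun s t h =>
        (hC.rel_toVariety s t).2 (Relation.ReflTransGen.single (Or.inr h))
  · intro h
    induction h with
    | refl => exact Or.inl rfl
    | tail _ h ih =>
      refine (fullyInvariant_rel _).trans ih ?_
      rcases h with h | h
      · exact (ComVariety.le_iff _ _).1 inf_le_left _ _ h
      · exact (ComVariety.le_iff _ _).1 inf_le_right _ _ h

/-! ### Words equal to zero -/

/-- The identity `s = 0` holds modulo `R`. -/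
def IsZeroWord (R : Multiset ℕ → Multiset ℕ → Prop) (s : Multiset ℕ) : Prop :=
  s ≠ 0 ∧ ∀ r, R (s + r) s

namespace FullyInvariant

variable {A B C : Multiset ℕ → Multiset ℕ → Prop}

theorem isZeroWord_add (hA : FullyInvariant A) {s : Multiset ℕ} (h : IsZeroWord A s)
    (r : Multiset ℕ) : IsZeroWord A (s + r) := by
  refine ⟨fun h0 => h.1 (add_eq_zero.1 h0).1, fun q => ?_⟩
  rw [add_assoc]
  exact hA.trans (h.2 _) (hA.symm (h.2 r))

theorem isZeroWord_of_le (hA : FullyInvariant A) {s t : Multiset ℕ} (h : IsZeroWord A s)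
    (hst : s ≤ t) : IsZeroWord A t := by
  obtain ⟨r, rfl⟩ := Multiset.le_iff_exists_add.1 hst
  exact hA.isZeroWord_add h r

theorem rel_of_isZeroWord (hA : FullyInvariant A) {s t : Multiset ℕ} (hs : IsZeroWord A s)
    (ht : IsZeroWord A t) : A s t :=
  hA.trans (hA.symm (hs.2 t)) (add_comm t s ▸ ht.2 s)

theorem isZeroWord_of_rel (hA : FullyInvariant A) {s t : Multiset ℕ} (h : A s t)
    (ht : IsZeroWord A t) : IsZeroWord A s :=
  ⟨hA.ne_zero (hA.symm h) ht.1, fun r =>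
    hA.trans (hA.add r h) (hA.trans (ht.2 r) (hA.symm h))⟩

theorem isZeroWord_bind (hA : FullyInvariant A) {s : Multiset ℕ} (hs : IsZeroWord A s)
    (φ : ℕ → Multiset ℕ) (hφ : ∀ i, φ i ≠ 0) : IsZeroWord A (s.bind φ) := by
  constructor
  · obtain ⟨a, ha⟩ := Multiset.exists_mem_of_ne_zero hs.1
    obtain ⟨b, hb⟩ := Multiset.exists_mem_of_ne_zero (hφ a)
    intro h0
    have : b ∈ s.bind φ := Multiset.mem_bind.2 ⟨a, ha, hb⟩
    rw [h0] at this
    exact Multiset.notMem_zero _ this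
  · intro r
    by_cases hr : r = 0
    · rw [hr, add_zero]
      exact hA.refl _
    obtain ⟨k, hk⟩ := Infinite.exists_notMem_finset s.toFinset
    rw [Multiset.mem_toFinset] at hk
    have h1 := hA.subst (Function.update φ k r) (fun i => by
      by_cases hi : i = k
      · subst hi
        simpa using hr
      · simpa [hi] using hφ i) (hs.2 {k})
    have h2 : s.bind (Function.update φ k r) = s.bind φ := Multiset.bind_congr fun i hi => by
      have : i ≠ k := fun h => hk (h ▸ hi)
      simp [this]
    rwa [Multiset.add_bind, h2, Multiset.singleton_bind, Function.update_self] at h1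

theorem isZeroWord_map (hA : FullyInvariant A) {s : Multiset ℕ} (hs : IsZeroWord A s)
    (f : ℕ → ℕ) : IsZeroWord A (s.map f) := by
  simpa only [Multiset.bind_singleton] using
    hA.isZeroWord_bind hs (fun i => {f i}) fun i => Multiset.singleton_ne_zero _

theorem isZeroWord_swapped (hA : FullyInvariant A) {s t : Multiset ℕ} (hs : IsZeroWord A s)
    (h : Swapped s t) : IsZeroWord A t := by
  obtain ⟨e, rfl, -⟩ := h.map_swap
  exact hA.isZeroWord_map hs e

theorem isZeroWord_add_nsmul (hA : FullyInvariant A) {N : ℕ}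
    (hN : IsZeroWord A (Multiset.replicate N 0)) {P : Multiset ℕ} (hP : P ≠ 0)
    (s : Multiset ℕ) {m : ℕ} (hm : N ≤ m) : IsZeroWord A (s + m • P) := by
  obtain ⟨a, ha⟩ := Multiset.exists_mem_of_ne_zero hP
  have h1 := hA.isZeroWord_map hN fun _ => a
  rw [Multiset.map_replicate] at h1
  refine hA.isZeroWord_of_le h1 (le_add_left ?_)
  rw [← Multiset.nsmul_singleton]
  exact (nsmul_le_nsmul_left (Multiset.zero_le _) hm).trans
    (nsmul_le_nsmul_right (Multiset.singleton_le.2 ha) m)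

/-- In a nil-variety a nontrivial identity on a linear or short word is of the form `s = 0` or
`a²b = ab²`. -/
theorem swapped_of_rel (hA : FullyInvariant A) {N : ℕ}
    (hN : IsZeroWord A (Multiset.replicate N 0)) {s w : Multiset ℕ} (hs0 : s ≠ 0)
    (hs : s.Nodup ∨ s.card ≤ 3) (hsZ : ¬ IsZeroWord A s) (h : A s w) (hw : w ≠ s) :
    Swapped s w := by
  by_contra hsw
  obtain ⟨P, hP, hdir⟩ := exists_direction hs0 hs
  obtain ⟨p, hp, h1⟩ := hdir A hA w h hw hsw
  have h2 := hA.nsmul h1 N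
  rw [← mul_smul] at h2
  exact hsZ (hA.isZeroWord_of_rel h2
    (hA.isZeroWord_add_nsmul hN hP s (Nat.le_mul_of_pos_right N hp)))

/-! ### The identities are sufficient -/

theorem exists_zero_of_chain (hA : FullyInvariant A) (hB : FullyInvariant B)
    (hC : FullyInvariant C) {N : ℕ} (hN : IsZeroWord A (Multiset.replicate N 0))
    (hlong : ∀ s : Multiset ℕ, ¬ s.Nodup → 4 ≤ s.card → IsZeroWord A s)
    {s t : Multiset ℕ} (hs0 : s ≠ 0) (hst : t ≠ s) (hsw : ¬ Swapped s t) (hCst : C s t)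
    (h : chain A B s t) : ∃ w, IsZeroWord A w ∧ (s = w ∨ B s w ∧ C s w) := by
  by_cases hsZ : IsZeroWord A s
  · exact ⟨s, hsZ, Or.inl rfl⟩
  have hsmall : s.Nodup ∨ s.card ≤ 3 := by
    by_contra hcon
    push Not at hcon
    exact hsZ (hlong s hcon.1 hcon.2)
  obtain ⟨v, hBv, hv, hvsw⟩ : ∃ v, B s v ∧ v ≠ s ∧ ¬ Swapped s v := by
    by_contra hno
    push Not at hno
    have key : t = s ∨ Swapped s t := by
      clear hst hsw hCst
      induction h with
      | refl => exact Or.inl rfl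
      | @tail w w' _ hstep ih =>
        rcases ih with rfl | hw
        · by_cases hw' : w' = w
          · exact Or.inl hw'
          · rcases hstep with hstep | hstep
            · exact Or.inr (hA.swapped_of_rel hN hs0 hsmall hsZ hstep hw')
            · exact Or.inr (hno w' hstep hw')
        · obtain ⟨e, he, he'⟩ := hw.map_swap
          have hmap : A s (w'.map e) ∨ B s (w'.map e) := by
            rw [← he']
            exact hstep.imp (hA.map e) (hB.map e)
          have hww : w'.map e = s ∨ Swapped s (w'.map e) := by
            by_cases hne : w'.map e = s
            · exact Or.inl hne
            · rcases hmap with hmap | hmap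
              · exact Or.inr (hA.swapped_of_rel hN hs0 hsmall hsZ hmap hne)
              · exact Or.inr (hno _ hmap hne)
          have hinj : Function.Injective (Multiset.map e) :=
            Multiset.map_injective e.injective
          rcases hww with hww | hww
          · rw [← he'] at hww
            exact Or.inr (hinj hww ▸ hw)
          · refine Or.inl (hinj ?_)
            rw [he]
            exact hww.right_unique hw
    exact key.elim hst hsw
  obtain ⟨P, hP, hdir⟩ := exists_direction hs0 hsmall
  obtain ⟨p, hp, h1⟩ := hdir B hB v hBv hv hvsw
  obtain ⟨q, hq, h2⟩ := hdir C hC t hCst hst hsw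
  have h3 := hB.nsmul h1 (N * q)
  have h4 := hC.nsmul h2 (N * p)
  rw [← mul_smul] at h3 h4
  have hcomm : N * p * q = N * q * p := by ring
  rw [hcomm] at h4
  refine ⟨_, hA.isZeroWord_add_nsmul hN hP s ?_, Or.inr ⟨h3, h4⟩⟩
  rw [mul_assoc]
  exact Nat.le_mul_of_pos_right N (Nat.mul_pos hq hp)

theorem chain_inter_of_chain (hA : FullyInvariant A) (hB : FullyInvariant B)
    (hC : FullyInvariant C) {N : ℕ} (hN : IsZeroWord A (Multiset.replicate N 0))
    (hlong : ∀ s : Multiset ℕ, ¬ s.Nodup → 4 ≤ s.card → IsZeroWord A s)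
    (hswap : ∀ s t, Swapped s t → A s t) {s t : Multiset ℕ} (hCst : C s t)
    (h : chain A B s t) :
    chain (fun s t => A s t ∧ C s t) (fun s t => B s t ∧ C s t) s t := by
  by_cases hst : t = s
  · rw [hst]
    exact Relation.ReflTransGen.refl
  by_cases hsw : Swapped s t
  · exact Relation.ReflTransGen.single (Or.inl ⟨hswap s t hsw, hCst⟩)
  have hs0 : s ≠ 0 := by
    rintro rfl
    exact hst (hC.zero hCst)
  have ht0 : t ≠ 0 := hC.ne_zero hCst hs0
  obtain ⟨w, hw, hsw'⟩ := hA.exists_zero_of_chain hB hC hN hlong hs0 hst hsw hCst h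
  obtain ⟨w', hw', htw'⟩ := hA.exists_zero_of_chain hB hC hN hlong ht0 (Ne.symm hst)
    (fun h => hsw h.symm) (hC.symm hCst) ((fullyInvariant_chain hA hB).symm h)
  have hCw : C s w := hsw'.elim (fun h => h ▸ hC.refl s) fun h => h.2
  have hCw' : C t w' := htw'.elim (fun h => h ▸ hC.refl t) fun h => h.2
  have hmid : A w w' ∧ C w w' :=
    ⟨hA.rel_of_isZeroWord hw hw', hC.trans (hC.symm hCw) (hC.trans hCst hCw')⟩
  have h1 : chain (fun s t => A s t ∧ C s t) (fun s t => B s t ∧ C s t) s w := by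
    rcases hsw' with rfl | h
    · exact Relation.ReflTransGen.refl
    · exact Relation.ReflTransGen.single (Or.inr h)
  have h2 : chain (fun s t => A s t ∧ C s t) (fun s t => B s t ∧ C s t) w' t := by
    rcases htw' with rfl | h
    · exact Relation.ReflTransGen.refl
    · exact Relation.ReflTransGen.single (Or.inr ⟨hB.symm h.1, hC.symm h.2⟩)
  exact (h1.tail (Or.inl hmid)).trans h2

/-! ### The identities are necessary -/

/-- The congruence identifying `a²b` with `ab²` and sending all words of length at least four
to zero, as well as the words that are zero modulo `A`. -/
def squareSwap (A : Multiset ℕ → Multiset ℕ → Prop) (s t : Multiset ℕ) : Prop :=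
  s = t ∨ Swapped s t ∨ ((IsZeroWord A s ∨ 4 ≤ s.card) ∧ (IsZeroWord A t ∨ 4 ≤ t.card))

theorem card_of_swapped {s t : Multiset ℕ} (h : Swapped s t) : s.card = 3 ∧ t.card = 3 := by
  obtain ⟨a, b, -, rfl, rfl⟩ := h
  exact ⟨rfl, rfl⟩

theorem card_le_card_bind (φ : ℕ → Multiset ℕ) (hφ : ∀ i, φ i ≠ 0) (s : Multiset ℕ) :
    s.card ≤ (s.bind φ).card := by
  induction s using Multiset.induction_on with
  | empty => simp
  | cons a s ih =>
    have := Multiset.card_pos.2 (hφ a)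
    rw [Multiset.cons_bind, Multiset.card_add, Multiset.card_cons]
    omega

theorem fullyInvariant_squareSwap (hA : FullyInvariant A) :
    FullyInvariant (squareSwap A) := by
  have hsat : ∀ {s t}, Swapped s t → (IsZeroWord A s ∨ 4 ≤ s.card) → IsZeroWord A t := by
    intro s t h hs
    refine hA.isZeroWord_swapped (hs.resolve_right ?_) h
    rw [(card_of_swapped h).1]
    omega
  refine ⟨fun s => Or.inl rfl, ?_, ?_, ?_, ?_, ?_⟩
  · rintro s t (rfl | h | h)
    · exact Or.inl rfl
    · exact Or.inr (Or.inl h.symm)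
    · exact Or.inr (Or.inr h.symm)
  · rintro s t r (rfl | h | h) h'
    · exact h'
    · rcases h' with rfl | h' | h'
      · exact Or.inr (Or.inl h)
      · exact Or.inl (h.symm.right_unique h')
      · exact Or.inr (Or.inr ⟨Or.inl (hsat h.symm h'.1), h'.2⟩)
    · rcases h' with rfl | h' | h'
      · exact Or.inr (Or.inr h)
      · exact Or.inr (Or.inr ⟨h.1, Or.inl (hsat h' h.2)⟩)
      · exact Or.inr (Or.inr ⟨h.1, h'.2⟩)
  · rintro s t r (rfl | h | h)
    · exact Or.inl rfl
    · by_cases hr : r = 0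
      · subst hr
        rw [add_zero, add_zero]
        exact Or.inr (Or.inl h)
      · have hr' := Multiset.card_pos.2 hr
        have hc := card_of_swapped h
        refine Or.inr (Or.inr ⟨Or.inr ?_, Or.inr ?_⟩) <;> rw [Multiset.card_add] <;> omega
    · have hadd : ∀ q : Multiset ℕ, IsZeroWord A q ∨ 4 ≤ q.card →
          IsZeroWord A (q + r) ∨ 4 ≤ (q + r).card := by
        rintro q (hq | hq)
        · exact Or.inl (hA.isZeroWord_add hq r)
        · rw [Multiset.card_add]
          exact Or.inr (by omega)
      exact Or.inr (Or.inr ⟨hadd s h.1, hadd t h.2⟩)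
  · rintro s t φ hφ (rfl | h | h)
    · exact Or.inl rfl
    · obtain ⟨a, b, hab, rfl, rfl⟩ := h
      have ha := Multiset.card_pos.2 (hφ a)
      have hb := Multiset.card_pos.2 (hφ b)
      by_cases h1 : (φ a).card = 1 ∧ (φ b).card = 1
      · obtain ⟨c, hc⟩ := Multiset.card_eq_one.1 h1.1
        obtain ⟨d, hd⟩ := Multiset.card_eq_one.1 h1.2
        by_cases hcd : c = d
        · subst hcd
          exact Or.inl (by simp [hc, hd])
        · exact Or.inr (Or.inl ⟨c, d, hcd, by simp [hc, hd],
            by simp [hc, hd, Multiset.cons_swap d c]⟩)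
      · refine Or.inr (Or.inr ⟨Or.inr ?_, Or.inr ?_⟩) <;>
          simp only [Multiset.insert_eq_cons, Multiset.cons_bind, Multiset.singleton_bind,
            Multiset.card_add] <;> omega
    · have hbind : ∀ q : Multiset ℕ, IsZeroWord A q ∨ 4 ≤ q.card →
          IsZeroWord A (q.bind φ) ∨ 4 ≤ (q.bind φ).card := by
        rintro q (hq | hq)
        · exact Or.inl (hA.isZeroWord_bind hq φ hφ)
        · exact Or.inr (hq.trans (card_le_card_bind φ hφ q))
      exact Or.inr (Or.inr ⟨hbind s h.1, hbind t h.2⟩)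
  · rintro t (rfl | h | h)
    · rfl
    · exact absurd (card_of_swapped h).1 (by simp)
    · rcases h.1 with h | h
      · exact absurd rfl h.1
      · exact absurd h (by simp)

/-- The theory of abelian groups of exponent `n` on commutative words. -/
def sumCongr (n : ℕ) (s t : Multiset ℕ) : Prop :=
  (s = 0 ↔ t = 0) ∧ ∀ σ : ℕ → ZMod n, (s.map σ).sum = (t.map σ).sum

theorem bind_eq_zero {φ : ℕ → Multiset ℕ} (hφ : ∀ i, φ i ≠ 0) {s : Multiset ℕ} :
    s.bind φ = 0 ↔ s = 0 := by
  constructor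
  · intro h
    have := card_le_card_bind φ hφ s
    rw [h, Multiset.card_zero, Nat.le_zero, Multiset.card_eq_zero] at this
    exact this
  · rintro rfl
    simp

theorem fullyInvariant_sumCongr (n : ℕ) : FullyInvariant (sumCongr n) where
  refl s := ⟨Iff.rfl, fun _ => rfl⟩
  symm h := ⟨h.1.symm, fun σ => (h.2 σ).symm⟩
  trans h h' := ⟨h.1.trans h'.1, fun σ => (h.2 σ).trans (h'.2 σ)⟩
  add r h := ⟨by rw [add_eq_zero, add_eq_zero, h.1], fun σ => by simp [h.2 σ]⟩
  subst φ hφ h := ⟨by rw [bind_eq_zero hφ, bind_eq_zero hφ, h.1], fun σ => by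
    rw [Multiset.map_bind, Multiset.map_bind, Multiset.sum_bind, Multiset.sum_bind, h.2]⟩
  zero h := h.1.1 rfl

end FullyInvariant

/-! ### Lattice-theoretic implications -/

theorem IsCostandard.isCodistributive {L : Type*} [Lattice L] {a : L} (h : IsCostandard a) :
    IsCodistributive a := by
  intro b c
  have h1 := h b (a ⊓ c)
  have h2 := h c b
  rw [sup_comm b, h2, sup_inf_self, ← inf_assoc, inf_sup_self, sup_comm c] at h1
  exact h1.symm

theorem IsCodistributive.isUpperModular {L : Type*} [Lattice L] {a : L}
    (h : IsCodistributive a) : IsUpperModular a := by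
  intro b c hb
  rw [h b c, inf_eq_right.2 hb]

/-! ### Nil-varieties -/

theorem content_spow (n : ℕ) : content (spow xw n) = Multiset.replicate (n + 1) 0 := by
  induction n with
  | zero => rfl
  | succ n ih =>
    rw [spow, content_mul, ih, Multiset.replicate_succ _ (n + 1)]
    rfl

theorem exists_isZeroWord_replicate {V : ComVariety} (hV : IsNilVariety V.1) :
    ∃ N, IsZeroWord (rel V) (Multiset.replicate N 0) := by
  have hA := fullyInvariant_rel V
  obtain ⟨z, hz, hpow⟩ := hV hA.wordCon.Quotient ⟨(xw : hA.wordCon.Quotient)⟩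
    (FullyInvariant.models_quotient_rel V)
  obtain ⟨n, hn⟩ := hpow (xw : hA.wordCon.Quotient)
  have hcoe : ∀ n, spow (xw : hA.wordCon.Quotient) n =
      ((spow xw n : Word) : hA.wordCon.Quotient) := by
    intro n
    induction n with
    | zero => rfl
    | succ n ih => rw [spow, ih, spow, Con.coe_mul]
  rw [hcoe] at hn
  refine ⟨n + 1, by simp, fun r => ?_⟩
  by_cases hr : r = 0
  · rw [hr, add_zero]
    exact hA.refl _
  · obtain ⟨w, rfl⟩ := exists_content_eq hr
    have h1 := (hz (w : hA.wordCon.Quotient)).1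
    rw [← hn, ← Con.coe_mul, hA.wordCon_eq, content_mul, content_spow] at h1
    exact h1

theorem idQ_mem_iff (V : ComVariety) : idQ ∈ V.1.th ↔ rel V {0, 0, 1} {0, 1, 1} :=
  mem_th_iff V w_xxy w_xyy

theorem rel_of_swapped {V : ComVariety} (h : idQ ∈ V.1.th) {s t : Multiset ℕ}
    (hst : Swapped s t) : rel V s t := by
  obtain ⟨a, b, -, rfl, rfl⟩ := hst
  simpa using (fullyInvariant_rel V).map (fun i => if i = 0 then a else b)
    ((idQ_mem_iff V).1 h)

theorem idQ_mem_of_swapped {V : ComVariety} {s t : Multiset ℕ} (hst : Swapped s t)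
    (h : rel V s t) : idQ ∈ V.1.th := by
  obtain ⟨a, b, hab, rfl, rfl⟩ := hst
  rw [idQ_mem_iff]
  simpa [hab.symm] using (fullyInvariant_rel V).map (fun i => if i = a then 0 else 1) h

theorem vSatZero_iff (V : ComVariety) :
    VSatZero V.1 w_xxyz ↔ IsZeroWord (rel V) {0, 0, 1, 2} := by
  have hA := fullyInvariant_rel V
  constructor
  · intro h
    have h1 : (w_xxyz * FreeSemigroup.of 3, w_xxyz) ∈ V.1.th := by
      rw [← V.1.closed]
      intro S _ hS σ
      have := (h S hS σ (σ 3)).1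
      simpa only [map_mul, FreeSemigroup.lift_of] using this
    refine ⟨by simp, fun r => ?_⟩
    by_cases hr : r = 0
    · rw [hr, add_zero]
      exact hA.refl _
    · have h2 : rel V ({0, 0, 1, 2} + {3}) {0, 0, 1, 2} := (mem_th_iff V _ _).1 h1
      have h3 := hA.subst (fun i => if i = 3 then r else {i})
        (fun i => by split_ifs <;> simp [hr]) h2
      rw [Multiset.add_bind, Multiset.singleton_bind, if_pos rfl] at h3
      exact h3
  · intro h S _ hS σ a
    have hmem : ∀ w, content w = {0, 0, 1, 2} + {3} → (w, w_xxyz) ∈ V.1.th := fun w hw => by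
      rw [mem_th_iff, hw]
      exact h.2 {3}
    have h1 := hS _ (hmem (w_xxyz * FreeSemigroup.of 3) rfl) (Function.update σ 3 a)
    have h2 := hS _ (hmem (FreeSemigroup.of 3 * w_xxyz) (by decide))
      (Function.update σ 3 a)
    simp only [w_xxyz, xw, yw, zw, map_mul, FreeSemigroup.lift_of, Function.update_self] at h1 h2 ⊢
    simpa using And.intro h1 h2

theorem isZeroWord_of_not_nodup {V : ComVariety} (h : VSatZero V.1 w_xxyz) {s : Multiset ℕ}
    (hs : ¬ s.Nodup) (hcard : 4 ≤ s.card) : IsZeroWord (rel V) s := by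
  have hA := fullyInvariant_rel V
  rw [Multiset.nodup_iff_ne_cons_cons] at hs
  push Not at hs
  obtain ⟨a, t, rfl⟩ := hs
  rw [Multiset.card_cons, Multiset.card_cons] at hcard
  obtain ⟨b, hb⟩ := Multiset.card_pos_iff_exists_mem.1 (show 0 < t.card by omega)
  obtain ⟨t, rfl⟩ := Multiset.exists_cons_of_mem hb
  rw [Multiset.card_cons] at hcard
  obtain ⟨c, hc⟩ := Multiset.card_pos_iff_exists_mem.1 (show 0 < t.card by omega)
  obtain ⟨t, rfl⟩ := Multiset.exists_cons_of_mem hc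
  have h1 := hA.isZeroWord_map ((vSatZero_iff V).1 h)
    fun i => if i = 0 then a else if i = 1 then b else c
  refine hA.isZeroWord_of_le h1 ?_
  simp

theorem vSatZero_of_idQ_mem {V : ComVariety} (hV : IsNilVariety V.1) (h : idQ ∈ V.1.th) :
    VSatZero V.1 w_xxyz := by
  have hA := fullyInvariant_rel V
  obtain ⟨N, hN⟩ := exists_isZeroWord_replicate hV
  rw [vSatZero_iff]
  have h0 := (idQ_mem_iff V).1 h
  have h1 : rel V {0, 0, 1, 2} {0, 1, 2, 1, 2} :=
    hA.subst (fun i => if i = 0 then {0} else {1, 2}) (fun i => by split_ifs <;> simp) h0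
  have h2 : rel V {0, 0, 1, 2, 2} {0, 1, 1, 2, 2} := hA.add {2, 2} h0
  have h3 : rel V {0, 0, 1, 2} ({0, 0, 1, 2} + {2}) := by
    refine hA.trans h1 (hA.symm ?_)
    convert h2 using 1 <;> decide
  have h4 := hA.nsmul h3 N
  exact hA.isZeroWord_of_rel h4 (hA.isZeroWord_add_nsmul hN (by simp) _ le_rfl)

theorem isCostandard_of_identities {V : ComVariety} (hV : IsNilVariety V.1)
    (hzero : VSatZero V.1 w_xxyz) (hQ : idQ ∈ V.1.th) : IsCostandard V := by
  intro Y Z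
  obtain ⟨N, hN⟩ := exists_isZeroWord_replicate hV
  refine le_antisymm (sup_le (inf_le_inf le_sup_left le_sup_left)
    (le_inf le_sup_right le_sup_right)) ((ComVariety.le_iff _ _).2 fun s t h => ?_)
  rw [rel_sup, rel_inf] at h
  rw [rel_inf]
  simpa only [chain, rel_sup] using
    (fullyInvariant_rel V).chain_inter_of_chain (fullyInvariant_rel Y) (fullyInvariant_rel Z) hN
      (fun s => isZeroWord_of_not_nodup hzero) (fun s t => rel_of_swapped hQ) h.2 h.1

theorem idQ_mem_of_isUpperModular {V : ComVariety} (hV : IsNilVariety V.1)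
    (hmod : IsUpperModular V) : idQ ∈ V.1.th := by
  by_contra hQ
  have hA := fullyInvariant_rel V
  obtain ⟨N, hN⟩ := exists_isZeroWord_replicate hV
  have hstep : ∀ s t, rel V s t → s ≠ 0 → t ≠ s → IsZeroWord (rel V) s ∨ 4 ≤ s.card := by
    intro s t h hs hts
    by_contra hcon
    push Not at hcon
    have hsw := hA.swapped_of_rel hN hs (Or.inr (by omega)) hcon.1 h hts
    exact hQ (idQ_mem_of_swapped hsw h)
  have hB := hA.fullyInvariant_squareSwap
  have hC := FullyInvariant.fullyInvariant_sumCongr (N + 2)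
  have hle : hB.toVariety ≤ V := by
    rw [ComVariety.le_iff]
    intro s t h
    rw [hB.rel_toVariety]
    by_cases hst : s = t
    · exact Or.inl hst
    · have hs : s ≠ 0 := by
        rintro rfl
        exact hst (hA.zero h).symm
      exact Or.inr (Or.inr ⟨hstep s t h hs (Ne.symm hst),
        hstep t s (hA.symm h) (hA.ne_zero h hs) hst⟩)
  have hswap : Swapped {0, 0, 1} {0, 1, 1} := ⟨0, 1, by simp, rfl, rfl⟩
  have hnotZero : ¬ IsZeroWord (rel V) {0, 0, 1} := fun h =>
    hQ ((idQ_mem_iff V).2 (hA.rel_of_isZeroWord h (hA.isZeroWord_swapped h hswap)))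
  have hright : rel (hB.toVariety ⊔ V ⊓ hC.toVariety) {0, 0, 1} {0, 1, 1} := by
    rw [rel_sup, hB.rel_toVariety, rel_inf]
    refine ⟨Or.inr (Or.inl hswap), ?_⟩
    have hsum : ∀ s : Multiset ℕ, s ≠ 0 → rel hC.toVariety s (s + (N + 2) • {0}) := by
      intro s hs
      rw [hC.rel_toVariety]
      refine ⟨by simp [hs], fun σ => ?_⟩
      rw [Multiset.map_add, Multiset.sum_add, Multiset.map_nsmul, Multiset.sum_nsmul, nsmul_eq_mul,
        ZMod.natCast_self, zero_mul, add_zero]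
    have hz := fun s => hA.isZeroWord_add_nsmul hN (Multiset.singleton_ne_zero 0) s
      (Nat.le_add_right N 2)
    refine Relation.ReflTransGen.head (Or.inr (hsum {0, 0, 1} (by simp))) ?_
    refine Relation.ReflTransGen.head (Or.inl (hA.rel_of_isZeroWord (hz {0, 0, 1})
      (hz {0, 1, 1}))) ?_
    exact Relation.ReflTransGen.single
      (Or.inr ((fullyInvariant_rel _).symm (hsum {0, 1, 1} (by simp))))
  rw [← hmod _ _ hle, rel_inf] at hright
  have hstay : ∀ t, chain (rel V) (rel (hB.toVariety ⊔ hC.toVariety)) {0, 0, 1} t →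
      t = {0, 0, 1} := by
    intro t h
    induction h with
    | refl => rfl
    | @tail w t _ h ih =>
      subst ih
      by_contra hne
      have hfour : ¬ (IsZeroWord (rel V) {0, 0, 1} ∨ 4 ≤ Multiset.card ({0, 0, 1} : Multiset ℕ)) :=
        fun h => h.elim hnotZero (by decide)
      rcases h with h | h
      · exact hfour (hstep _ _ h (by simp) hne)
      · rw [rel_sup, hB.rel_toVariety, hC.rel_toVariety] at h
        obtain ⟨h | h | h, hsum⟩ := h
        · exact hne h.symm
        · obtain rfl := h.right_unique hswap
          have h1 := hsum.2 fun i => if i = 0 then 1 else 0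
          have : Nontrivial (ZMod (N + 2)) := ZMod.nontrivial_iff.2 (by omega)
          simp at h1
        · exact hfour h.1
  exact absurd (hstay _ hright) (by decide)

/-- For a commutative nil-variety `V`: upper-modular ⟺
codistributive ⟺ costandard in **Com** ⟺ `V` satisfies `x²yz = 0` and
`x²y = xy²`. -/
theorem nil_upperModular_iff_codistributive_iff_costandard (V : ComVariety)
    (hV : IsNilVariety V.1) :
    (IsUpperModular V ↔ IsCodistributive V) ∧
    (IsCodistributive V ↔ IsCostandard V) ∧
    (IsCostandard V ↔ (VSatZero V.1 w_xxyz ∧ idQ ∈ V.1.th)) := by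
  have hd : IsUpperModular V → VSatZero V.1 w_xxyz ∧ idQ ∈ V.1.th := fun h =>
    have hQ := idQ_mem_of_isUpperModular hV h
    ⟨vSatZero_of_idQ_mem hV hQ, hQ⟩
  have hc : VSatZero V.1 w_xxyz ∧ idQ ∈ V.1.th → IsCostandard V := fun h =>
    isCostandard_of_identities hV h.1 h.2
  exact ⟨⟨fun h => (hc (hd h)).isCodistributive, fun h => h.isUpperModular⟩,
    ⟨fun h => hc (hd h.isUpperModular), fun h => h.isCodistributive⟩,
    ⟨fun h => hd h.isCodistributive.isUpperModular, hc⟩⟩
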